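/- Let n be an even positive integer and ξ a complex non-real algebraic number with deg ξ > 2n−2 and t_n(ξ) > (n+1)/2. Then 1, ξ + ξ̄, ξ·ξ̄ are linearly dependent over ℚ. -/

import Mathlib

open Polynomial

/-- The ℚ-vector space of polynomials `f ∈ ℚ[X]` of degree at most `n`
with `μ * f(ξ) ∈ ℝ`. -/
noncomputable def Vspace (n : ℕ) (μ ξ : ℂ) : Submodule ℚ ℚ[X] where
  carrier := {f | f.natDegree ≤ n ∧ ∃ r : ℝ, μ * aeval ξ f = (r : ℂ)}
  zero_mem' := ⟨by simp, 0, by simp⟩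
  add_mem' := by
    rintro f g ⟨hf, r, hr⟩ ⟨hg, s, hs⟩
    refine ⟨(natDegree_add_le f g).trans (by simp [hf, hg]), r + s, ?_⟩
    push_cast
    rw [map_add, mul_add, hr, hs]
  smul_mem' := by
    rintro c f ⟨hf, r, hr⟩
    refine ⟨(natDegree_smul_le c f).trans hf, c * r, ?_⟩
    rw [map_smul, Algebra.mul_smul_comm, hr, Rat.smul_def]
    push_cast
    ring

/-- `t_n(ξ)`: the maximum over nonzero `μ ∈ ℂ` of `dim_ℚ V_n(μ,ξ)`. -/
noncomputable def tdeg (n : ℕ) (ξ : ℂ) : ℕ :=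
  sSup {d : ℕ | ∃ μ : ℂ, μ ≠ 0 ∧ d = Module.finrank ℚ (Vspace n μ ξ)}

lemma mem_Vspace_iff {n : ℕ} {μ ξ : ℂ} {f : ℚ[X]} :
    f ∈ Vspace n μ ξ ↔ f.natDegree ≤ n ∧ ∃ r : ℝ, μ * aeval ξ f = (r : ℂ) := Iff.rfl

lemma le_degreeLT_iff_aux {n : ℕ} {f : ℚ[X]} :
    f ∈ degreeLT ℚ (n + 1) ↔ f.natDegree ≤ n := by
  rw [mem_degreeLT]
  by_cases hf : f = 0
  · simp [hf]
  · rw [← natDegree_lt_iff_degree_lt hf, Nat.lt_succ_iff]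

lemma finrank_degreeLT_aux (n : ℕ) : Module.finrank ℚ (degreeLT ℚ n) = n := by
  rw [(degreeLTEquiv ℚ n).finrank_eq]; simp

lemma finite_degreeLT_aux (n : ℕ) : Module.Finite ℚ (degreeLT ℚ n) :=
  Module.Finite.equiv (degreeLTEquiv ℚ n).symm

lemma Vspace_le_aux (n : ℕ) (μ ξ : ℂ) : Vspace n μ ξ ≤ degreeLT ℚ (n + 1) :=
  fun _ hf => le_degreeLT_iff_aux.2 hf.1

lemma finite_Vspace_aux (n : ℕ) (μ ξ : ℂ) : Module.Finite ℚ (Vspace n μ ξ) :=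
  have := finite_degreeLT_aux (n + 1)
  Submodule.finiteDimensional_of_le (Vspace_le_aux n μ ξ)

lemma aeval_ne_zero_aux {ξ : ℂ} {f : ℚ[X]} (hf : f ≠ 0)
    (hd : f.natDegree < (minpoly ℚ ξ).natDegree) : aeval ξ f ≠ 0 := by
  intro h
  exact absurd (natDegree_le_of_dvd (minpoly.dvd ℚ ξ h) hf) (by omega)

lemma mulX_le_aux (n : ℕ) (μ ξ : ℂ) :
    Vspace n μ ξ ⊔ (Vspace n μ ξ).map (LinearMap.mulLeft ℚ (X : ℚ[X])) ≤
      degreeLT ℚ (n + 2) := by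
  refine sup_le ?_ ?_
  · intro f hf
    exact le_degreeLT_iff_aux.2 (hf.1.trans (by omega))
  · rintro _ ⟨f, hf, rfl⟩
    refine le_degreeLT_iff_aux.2 ?_
    rw [LinearMap.mulLeft_apply]
    have := natDegree_mul_le (p := (X : ℚ[X])) (q := f)
    have h2 := hf.1
    simp only [natDegree_X] at this
    omega

lemma finrank_mulX_aux (n : ℕ) (μ ξ : ℂ) (hμ : μ ≠ 0) (hξ : ξ.im ≠ 0)
    (hd : n < (minpoly ℚ ξ).natDegree) :
    Module.finrank ℚ ↥(Vspace n μ ξ ⊔ (Vspace n μ ξ).map (LinearMap.mulLeft ℚ (X : ℚ[X]))) =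
      2 * Module.finrank ℚ (Vspace n μ ξ) := by
  have := finite_Vspace_aux n μ ξ
  have h1 := Submodule.finrank_sup_add_finrank_inf_eq (Vspace n μ ξ)
    ((Vspace n μ ξ).map (LinearMap.mulLeft ℚ (X : ℚ[X])))
  have h2 : Module.finrank ℚ ((Vspace n μ ξ).map (LinearMap.mulLeft ℚ (X : ℚ[X]))) =
      Module.finrank ℚ (Vspace n μ ξ) :=
    (Submodule.equivMapOfInjective _ (by
      intro a b hab
      simpa [X_ne_zero] using hab) _).finrank_eq.symm
  have h3 : Vspace n μ ξ ⊓ (Vspace n μ ξ).map (LinearMap.mulLeft ℚ (X : ℚ[X])) = ⊥ := by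
    rw [Submodule.eq_bot_iff]
    rintro _ ⟨hf, g, hg, rfl⟩
    obtain ⟨-, r, hr⟩ := hf
    obtain ⟨hgd, s, hs⟩ := hg
    rw [LinearMap.mulLeft_apply] at hr ⊢
    rw [map_mul, aeval_X, mul_left_comm, hs] at hr
    have him := congrArg Complex.im hr
    simp [hξ] at him
    rw [him] at hs
    by_cases hg0 : g = 0
    · simp [hg0]
    · exact absurd hs (by
        simpa [hμ] using aeval_ne_zero_aux (ξ := ξ) hg0 (by omega))
  rw [h3, h2] at h1
  simp at h1
  omega

lemma two_mul_finrank_aux (n : ℕ) (μ ξ : ℂ) (hμ : μ ≠ 0) (hξ : ξ.im ≠ 0)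
    (hd : n < (minpoly ℚ ξ).natDegree) :
    2 * Module.finrank ℚ (Vspace n μ ξ) ≤ n + 2 := by
  rw [← finrank_mulX_aux n μ ξ hμ hξ hd, ← finrank_degreeLT_aux (n + 2)]
  have := finite_degreeLT_aux (n + 2)
  exact Submodule.finrank_mono (mulX_le_aux n μ ξ)

/-- If the dimension is maximal, multiplication by trace and norm is realised. -/
lemma trace_norm_aux (n : ℕ) (μ ξ : ℂ) (hμ : μ ≠ 0) (hξ : ξ.im ≠ 0)
    (hd : n < (minpoly ℚ ξ).natDegree)
    (hV : 2 * Module.finrank ℚ (Vspace n μ ξ) = n + 2) (f : ℚ[X])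
    (hf : f ∈ Vspace n μ ξ ⊓ degreeLT ℚ n) :
    (∃ h : ℚ[X], h.natDegree ≤ n ∧ aeval ξ h = (ξ + (starRingEnd ℂ) ξ) * aeval ξ f) ∧
    (∃ h : ℚ[X], h.natDegree ≤ n ∧ aeval ξ h = (ξ * (starRingEnd ℂ) ξ) * aeval ξ f) := by
  have := finite_degreeLT_aux (n + 2)
  have htop := Submodule.eq_of_le_of_finrank_eq (mulX_le_aux n μ ξ)
    (by rw [finrank_mulX_aux n μ ξ hμ hξ hd, hV, finrank_degreeLT_aux])
  have hmem : X ^ 2 * f ∈ degreeLT ℚ (n + 2) := by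
    by_cases hf0 : f = 0
    · simp [hf0]
    have h1 := mem_degreeLT.1 hf.2
    rw [← natDegree_lt_iff_degree_lt hf0] at h1
    refine le_degreeLT_iff_aux.2 (natDegree_mul_le.trans ?_)
    rw [natDegree_X_pow]; omega
  rw [← htop, Submodule.mem_sup] at hmem
  obtain ⟨g, ⟨hgd, s, hs⟩, _, ⟨h, ⟨hhd, t, ht⟩, rfl⟩, hgh⟩ := hmem
  obtain ⟨-, r, hr⟩ := hf.1
  rw [LinearMap.mulLeft_apply] at hgh
  have e1 : ξ ^ 2 * r = s + ξ * t := by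
    rw [← hr, ← hs, ← ht]
    have := congrArg (aeval ξ) hgh
    simp only [map_add, map_mul, aeval_X, map_pow] at this
    linear_combination -μ * this
  have e2 := congrArg (starRingEnd ℂ) e1
  simp only [map_add, map_mul, map_pow, Complex.conj_ofReal] at e2
  have hne : ξ - (starRingEnd ℂ) ξ ≠ 0 := by
    intro h0
    exact hξ (Complex.conj_eq_iff_im.1 (sub_eq_zero.1 h0).symm)
  have e3 : (ξ + (starRingEnd ℂ) ξ) * r = t := by
    apply mul_left_cancel₀ hne
    linear_combination e1 - e2
  have e4 : (ξ * (starRingEnd ℂ) ξ) * r = -s := by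
    linear_combination ξ * e3 - e1
  refine ⟨⟨h, hhd, ?_⟩, ⟨-g, by simpa using hgd, ?_⟩⟩
  · apply mul_left_cancel₀ hμ
    linear_combination ht - e3 + (ξ + (starRingEnd ℂ) ξ) * (-hr)
  · apply mul_left_cancel₀ hμ
    rw [map_neg]
    linear_combination -hs - e4 + (ξ * (starRingEnd ℂ) ξ) * (-hr)

/-- The degree is even as soon as the conjugate lies in the field generated. -/
lemma even_degree_aux (ξ : ℂ) (hξ : ξ.im ≠ 0) (halg : IsAlgebraic ℚ ξ)
    (hc : (starRingEnd ℂ) ξ ∈ IntermediateField.adjoin ℚ {ξ}) :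
    Even (minpoly ℚ ξ).natDegree := by
  set K := IntermediateField.adjoin ℚ {ξ} with hK
  have hintegral : IsIntegral ℚ ξ := halg.isIntegral
  have hfr : Module.finrank ℚ K = (minpoly ℚ ξ).natDegree :=
    IntermediateField.adjoin.finrank hintegral
  have hfin : Module.Finite ℚ K := IntermediateField.adjoin.finiteDimensional hintegral
  have hξK : ξ ∈ K := IntermediateField.mem_adjoin_simple_self ℚ ξ
  have hconj : ∀ z ∈ K, (starRingEnd ℂ) z ∈ K := by
    intro z hz
    have hz' : z ∈ K.toSubalgebra := hz
    rw [hK, IntermediateField.adjoin_simple_toSubalgebra_of_isAlgebraic halg,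
      Algebra.adjoin_singleton_eq_range_aeval] at hz'
    obtain ⟨p, rfl⟩ := hz'
    have : (starRingEnd ℂ) (aeval ξ p) = aeval ((starRingEnd ℂ) ξ) p := by
      simp [aeval_eq_sum_range, Algebra.smul_def]
    change (starRingEnd ℂ) (aeval ξ p) ∈ K
    rw [this]
    have h2 : aeval ((starRingEnd ℂ) ξ) p = (aeval (⟨(starRingEnd ℂ) ξ, hc⟩ : K) p : K) := by
      have := aeval_algebraMap_apply ℂ (⟨(starRingEnd ℂ) ξ, hc⟩ : K) p
      exact this
    rw [h2]
    exact SetLike.coe_mem _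
  let Km : Submodule ℚ ℂ := K.toSubalgebra.toSubmodule
  have hKm : ∀ z, z ∈ Km ↔ z ∈ K := fun z => Iff.rfl
  have hKmfr : Module.finrank ℚ Km = (minpoly ℚ ξ).natDegree := hfr
  have hKmfin : Module.Finite ℚ Km := hfin
  let K0 : Submodule ℚ ℂ := Km ⊓
    { carrier := {z | (starRingEnd ℂ) z = z}
      zero_mem' := by simp
      add_mem' := by
        intro a b ha hb
        simp only [Set.mem_ofPred_eq] at *
        rw [map_add, ha, hb]
      smul_mem' := by
        intro c a ha
        simp only [Set.mem_ofPred_eq] at *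
        rw [Algebra.smul_def, map_mul, ha]; simp }
  have hK0 : ∀ z, z ∈ K0 ↔ z ∈ K ∧ (starRingEnd ℂ) z = z := fun z => Iff.rfl
  have hK0fin : Module.Finite ℚ K0 := Submodule.finiteDimensional_of_le (inf_le_left : K0 ≤ Km)
  set δ := ξ - (starRingEnd ℂ) ξ with hδ
  have hne : δ ≠ 0 := by
    intro h0
    exact hξ (Complex.conj_eq_iff_im.1 (sub_eq_zero.1 h0).symm)
  have hδc : (starRingEnd ℂ) δ = -δ := by simp [hδ]
  have hδK : δ ∈ K := sub_mem hξK hc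
  let K1 := K0.map (LinearMap.mulLeft ℚ δ)
  have h1 := Submodule.finrank_sup_add_finrank_inf_eq K0 K1
  have h2 : Module.finrank ℚ K1 = Module.finrank ℚ K0 :=
    (Submodule.equivMapOfInjective _ (by
      intro a b hab
      simpa [hne] using hab) _).finrank_eq.symm
  have h3 : K0 ⊓ K1 = ⊥ := by
    rw [Submodule.eq_bot_iff]
    rintro _ ⟨ha, b, hb, rfl⟩
    have ha := ((hK0 _).1 ha).2
    have hb := ((hK0 _).1 hb).2
    rw [LinearMap.mulLeft_apply, map_mul, hδc, hb] at ha
    rw [LinearMap.mulLeft_apply]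
    linear_combination -ha / 2
  have h4 : K0 ⊔ K1 = Km := by
    apply le_antisymm
    · refine sup_le inf_le_left ?_
      rintro _ ⟨b, hb, rfl⟩
      exact (hKm _).2 (mul_mem hδK ((hK0 _).1 hb).1)
    · intro z hz
      have hz : z ∈ K := hz
      have hzc := hconj z hz
      have two : (2 : ℂ) ∈ K := ofNat_mem K 2
      rw [Submodule.mem_sup]
      refine ⟨(z + (starRingEnd ℂ) z) / 2, (hK0 _).2 ⟨div_mem (add_mem hz hzc) two, ?_⟩,
        _, ⟨(z - (starRingEnd ℂ) z) / (2 * δ), (hK0 _).2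
          ⟨div_mem (sub_mem hz hzc) (mul_mem two hδK), ?_⟩, rfl⟩, ?_⟩
      · simp only [map_div₀, map_add, Complex.conj_conj, map_ofNat]
        rw [add_comm]
      · simp only [map_div₀, map_sub, map_mul, hδc, Complex.conj_conj, map_ofNat]
        field_simp
        ring
      · rw [LinearMap.mulLeft_apply]
        field_simp
        ring
  rw [h3, h4, h2, hKmfr] at h1
  simp at h1
  exact ⟨_, h1⟩

lemma small_multiplier_aux (n : ℕ) (μ ξ : ℂ) (hμ : μ ≠ 0) (hξ : ξ.im ≠ 0)
    (hn : 0 < n) (hd : 2 * n ≤ (minpoly ℚ ξ).natDegree) (W : Submodule ℚ ℚ[X])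
    (hW : W ≤ Vspace n μ ξ ⊓ degreeLT ℚ n) (hr : n ≤ 2 * Module.finrank ℚ W)
    (D : ℚ[X]) (hD : Ideal.span (W : Set ℚ[X]) = Ideal.span {D}) (hDξ : aeval ξ D ≠ 0)
    (s : ℂ) (hs : ∀ f ∈ W, ∃ h : ℚ[X], h.natDegree ≤ n ∧ aeval ξ h = s * aeval ξ f) :
    ∃ p : ℚ[X], p.natDegree ≤ 2 ∧ aeval ξ p = s * aeval ξ D := by
  have hWd : ∀ f ∈ W, f.natDegree < n := by
    intro f hf
    have h1 := mem_degreeLT.1 (hW hf).2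
    by_cases hf0 : f = 0
    · simpa [hf0] using hn
    · rwa [← natDegree_lt_iff_degree_lt hf0] at h1
  choose! φ hφd hφ using hs
  have key : ∀ f ∈ W, ∀ g ∈ W, φ g * f = g * φ f := by
    intro f hf g hg
    by_contra hne
    refine aeval_ne_zero_aux (ξ := ξ) (sub_ne_zero.2 hne) ?_ ?_
    · have h1 := natDegree_sub_le (φ g * f) (g * φ f)
      have h2 := natDegree_mul_le (p := φ g) (q := f)
      have h3 := natDegree_mul_le (p := g) (q := φ f)
      have := hφd f hf
      have := hφd g hg
      have := hWd f hf
      have := hWd g hg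
      have : max (φ g * f).natDegree (g * φ f).natDegree ≤ 2 * n - 1 :=
        max_le (by omega) (by omega)
      omega
    · simp only [map_sub, map_mul, hφ f hf, hφ g hg]
      ring
  have hspan : ∀ q ∈ Ideal.span (W : Set ℚ[X]), ∃ p : ℚ[X], ∀ f ∈ W, p * f = q * φ f := by
    intro q hq
    induction hq using Submodule.span_induction with
    | mem g hg => exact ⟨φ g, fun f hf => key f hf g hg⟩
    | zero => exact ⟨0, by simp⟩
    | add a b _ _ ha hb =>
      obtain ⟨p, hp⟩ := ha
      obtain ⟨p', hp'⟩ := hb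
      exact ⟨p + p', fun f hf => by rw [add_mul, add_mul, hp f hf, hp' f hf]⟩
    | smul a b _ hb =>
      obtain ⟨p, hp⟩ := hb
      exact ⟨a * p, fun f hf => by rw [smul_eq_mul, mul_assoc, mul_assoc, hp f hf]⟩
  obtain ⟨p, hp⟩ := hspan D (by rw [hD]; exact Ideal.mem_span_singleton_self D)
  have hD0 : D ≠ 0 := by rintro rfl; simp at hDξ
  have hWne : W ≠ ⊥ := by
    rintro rfl
    simp at hr
    omega
  obtain ⟨f, hf, hf0⟩ := Submodule.exists_mem_ne_zero_of_ne_bot hWne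
  have hfξ : aeval ξ f ≠ 0 := aeval_ne_zero_aux hf0 (by have := hWd f hf; omega)
  have hpξ : aeval ξ p = s * aeval ξ D := by
    apply mul_right_cancel₀ hfξ
    have := congrArg (aeval ξ) (hp f hf)
    simp only [map_mul, hφ f hf] at this
    rw [this]; ring
  refine ⟨p, ?_, hpξ⟩
  by_cases hp0 : p = 0
  · simp [hp0]
  have hdvd : ∀ g ∈ W, D ∣ g := by
    intro g hg
    rw [← Ideal.mem_span_singleton, ← hD]
    exact Ideal.subset_span hg
  have hdegu : ∀ u : ℚ[X], u ≠ 0 → D * u ∈ W → p.natDegree + u.natDegree ≤ n := by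
    intro u hu huW
    have h1 := hp _ huW
    have h2 : p * u = φ (D * u) := by
      apply mul_left_cancel₀ hD0
      rw [← h1]; ring
    rw [← natDegree_mul hp0 hu, h2]
    exact hφd _ huW
  obtain ⟨u, rfl⟩ := hdvd f hf
  have hpn : p.natDegree ≤ n := by
    have := hdegu u (by rintro rfl; simp at hf0) hf
    omega
  have hmap : W ≤ (Vspace (n - p.natDegree) (μ * aeval ξ D) ξ).map (LinearMap.mulLeft ℚ D) := by
    intro g hg
    obtain ⟨v, rfl⟩ := hdvd g hg
    refine ⟨v, ⟨?_, ?_⟩, rfl⟩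
    · by_cases hv : v = 0
      · simp [hv]
      · have := hdegu v hv hg
        omega
    · obtain ⟨-, r, hr⟩ := (hW hg).1
      exact ⟨r, by rw [← hr, map_mul, mul_assoc]⟩
  have := finite_Vspace_aux (n - p.natDegree) (μ * aeval ξ D) ξ
  have h1 := Submodule.finrank_mono hmap
  have h2 := Submodule.finrank_map_le (LinearMap.mulLeft ℚ D)
    (Vspace (n - p.natDegree) (μ * aeval ξ D) ξ)
  have h3 := two_mul_finrank_aux (n - p.natDegree) (μ * aeval ξ D) ξ (mul_ne_zero hμ hDξ) hξ
    (by omega)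
  omega

theorem lin_dep_of_large_tdeg (n : ℕ) (hn : 0 < n) (hne : Even n) (ξ : ℂ)
    (hξreal : ξ.im ≠ 0) (hξalg : IsAlgebraic ℚ ξ)
    (hdeg : 2 * n - 2 < (minpoly ℚ ξ).natDegree)
    (ht : n + 1 < 2 * tdeg n ξ) :
    ∃ a b c : ℚ, ¬(a = 0 ∧ b = 0 ∧ c = 0) ∧
      (a : ℂ) + (b : ℂ) * (ξ + (starRingEnd ℂ) ξ)
        + (c : ℂ) * (ξ * (starRingEnd ℂ) ξ) = 0 := by
  have hdn : n < (minpoly ℚ ξ).natDegree := by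
    obtain ⟨k, rfl⟩ := hne
    omega
  obtain ⟨μ, hμ, hμd⟩ : ∃ μ : ℂ, μ ≠ 0 ∧ tdeg n ξ = Module.finrank ℚ (Vspace n μ ξ) := by
    have hmem := Nat.sSup_mem (s := {d : ℕ | ∃ μ : ℂ, μ ≠ 0 ∧ d = Module.finrank ℚ (Vspace n μ ξ)})
      ⟨_, 1, one_ne_zero, rfl⟩ ⟨n + 2, by
        rintro _ ⟨μ, hμ, rfl⟩
        have := two_mul_finrank_aux n μ ξ hμ hξreal hdn
        omega⟩
    exact hmem
  have hV : 2 * Module.finrank ℚ (Vspace n μ ξ) = n + 2 := by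
    have := two_mul_finrank_aux n μ ξ hμ hξreal hdn
    omega
  set W := Vspace n μ ξ ⊓ degreeLT ℚ n with hW
  have hWr : n ≤ 2 * Module.finrank ℚ W := by
    have := finite_degreeLT_aux n
    have := finite_degreeLT_aux (n + 1)
    have := finite_Vspace_aux n μ ξ
    have h1 := Submodule.finrank_sup_add_finrank_inf_eq (Vspace n μ ξ) (degreeLT ℚ n)
    have h2 : Module.finrank ℚ ↥(Vspace n μ ξ ⊔ degreeLT ℚ n) ≤ n + 1 := by
      rw [← finrank_degreeLT_aux (n + 1)]
      exact Submodule.finrank_mono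
        (sup_le (Vspace_le_aux n μ ξ) (degreeLT_mono (Nat.le_succ n)))
    rw [finrank_degreeLT_aux, ← hW] at h1
    omega
  have hWne : W ≠ ⊥ := by
    intro h0
    rw [h0] at hWr
    simp at hWr
    omega
  obtain ⟨f, hf, hf0⟩ := Submodule.exists_mem_ne_zero_of_ne_bot hWne
  have hfξ : aeval ξ f ≠ 0 := aeval_ne_zero_aux hf0 (lt_of_le_of_lt hf.1.1 hdn)
  have htn := trace_norm_aux n μ ξ hμ hξreal hdn hV
  have heven : Even (minpoly ℚ ξ).natDegree := by
    apply even_degree_aux ξ hξreal hξalg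
    obtain ⟨⟨h, -, hh⟩, -⟩ := htn f hf
    have hmem : ∀ q : ℚ[X], aeval ξ q ∈ IntermediateField.adjoin ℚ {ξ} := fun q =>
      IntermediateField.algebra_adjoin_le_adjoin ℚ {ξ} (aeval_mem_adjoin_singleton ℚ ξ)
    have e : (starRingEnd ℂ) ξ = aeval ξ h / aeval ξ f - ξ := by
      rw [hh]; field_simp; ring
    rw [e]
    exact sub_mem (div_mem (hmem h) (hmem f)) (IntermediateField.mem_adjoin_simple_self ℚ ξ)
  have hd2 : 2 * n ≤ (minpoly ℚ ξ).natDegree := by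
    obtain ⟨k, hk⟩ := heven
    omega
  obtain ⟨D, hD⟩ : ∃ D, Ideal.span (W : Set ℚ[X]) = Ideal.span {D} :=
    (IsPrincipalIdealRing.principal (Ideal.span (W : Set ℚ[X]))).principal
  have hDf : D ∣ f := by
    rw [← Ideal.mem_span_singleton, ← hD]
    exact Ideal.subset_span hf
  have hDξ : aeval ξ D ≠ 0 := by
    obtain ⟨u, rfl⟩ := hDf
    rw [map_mul] at hfξ
    exact left_ne_zero_of_mul hfξ
  have hsm := small_multiplier_aux n μ ξ hμ hξreal hn hd2 W le_rfl hWr D hD hDξ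
  obtain ⟨p₁, hd₁, hp₁⟩ := hsm 1 (fun f hf => ⟨f, hf.1.1, by simp⟩)
  obtain ⟨p₂, hd₂, hp₂⟩ := hsm _ (fun f hf => (htn f hf).1)
  obtain ⟨p₃, hd₃, hp₃⟩ := hsm _ (fun f hf => (htn f hf).2)
  have hfin := finite_Vspace_aux 2 (aeval ξ D)⁻¹ ξ
  have h2 := two_mul_finrank_aux 2 (aeval ξ D)⁻¹ ξ (inv_ne_zero hDξ) hξreal (by
    obtain ⟨k, rfl⟩ := hne
    omega)
  have hm₁ : p₁ ∈ Vspace 2 (aeval ξ D)⁻¹ ξ := ⟨hd₁, 1, by rw [hp₁]; field_simp; simp⟩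
  have hm₂ : p₂ ∈ Vspace 2 (aeval ξ D)⁻¹ ξ := ⟨hd₂, 2 * ξ.re, by
    rw [hp₂, Complex.add_conj]; field_simp⟩
  have hm₃ : p₃ ∈ Vspace 2 (aeval ξ D)⁻¹ ξ := ⟨hd₃, Complex.normSq ξ, by
    rw [hp₃, Complex.mul_conj]; field_simp⟩
  have hdep : ¬ LinearIndependent ℚ
      ![(⟨p₁, hm₁⟩ : Vspace 2 (aeval ξ D)⁻¹ ξ), ⟨p₂, hm₂⟩, ⟨p₃, hm₃⟩] := by
    intro hli
    have := hli.fintype_card_le_finrank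
    simp at this
    omega
  rw [Fintype.not_linearIndependent_iff] at hdep
  obtain ⟨g, hg, i, hi⟩ := hdep
  refine ⟨g 0, g 1, g 2, ?_, ?_⟩
  · rintro ⟨h0, h1, h2⟩
    fin_cases i <;> simp_all
  · have h := congrArg (fun v : Vspace 2 (aeval ξ D)⁻¹ ξ => aeval ξ (v : ℚ[X])) hg
    simp only [Fin.sum_univ_three, Submodule.coe_add, Submodule.coe_smul, map_add, map_smul,
      Matrix.cons_val_zero, Matrix.cons_val_one, Matrix.cons_val, hp₁, hp₂, hp₃,
      ZeroMemClass.coe_zero, map_zero, Rat.smul_def] at h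
    apply mul_right_cancel₀ hDξ
    linear_combination h
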